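/- arXiv:1610.02465 — 13 statements merged into one kernel-verified Lean document; each statement's English description precedes it below -/
import Mathlib

section
/- Let G1 and G2 be FDESs over the same finite event set E with m and n crisp states respectively, with data (x01, xm1, σ1) and (x02, xm2, σ2). Let A be the finite set consisting of all entries of the vectors x01, xm1, x02, xm2 and of all the matrices σ1(e), σ2(e) for e ∈ E. Suppose φ is an m×n matrix over [0,1] that is a fuzzy simulation from G1 to G2, and suppose that for every pair of indices (i,j) there exists some a ∈ A with a ≥ φ(i,j). Define the m×n matrix φ↑ by φ↑(i,j) = min{ a ∈ A : a ≥ φ(i,j) }. Then φ↑ is also a fuzzy simulation from G1 to G2. -/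
open unitInterval

/-- A fuzzy discrete event system (FDES) over event set `E` with crisp state
index type `S`: fuzzy initial state vector, fuzzy marked state vector, and an
`S × S` fuzzy event matrix for each event, with entries in `[0,1]`. -/
structure FDES (E : Type) (S : Type) where
  x0 : S → unitInterval
  xm : S → unitInterval
  sig : E → S → S → unitInterval

/-- Max-min product of matrices over `[0,1]`. -/
noncomputable def maxmin {α β γ : Type} [Fintype β]
    (A : α → β → unitInterval) (B : β → γ → unitInterval) : α → γ → unitInterval :=
  fun i k => Finset.univ.sup fun j => A i j ⊓ B j k

/-- Max-min product of a (row) vector with a matrix. -/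
noncomputable def vecMat {β γ : Type} [Fintype β]
    (x : β → unitInterval) (B : β → γ → unitInterval) : γ → unitInterval :=
  fun k => Finset.univ.sup fun j => x j ⊓ B j k

/-- `φ` is a fuzzy simulation from `G1` to `G2`:
(a) `x01 ≤ x02 ⊙ φᵀ`, (b) `xm1 ⊙ φ ≤ xm2`, (c) `φᵀ ⊙ σ1(e) ≤ σ2(e) ⊙ φᵀ` for all `e`. -/
def IsFuzzySim {E S1 S2 : Type} [Fintype S1] [Fintype S2]
    (G1 : FDES E S1) (G2 : FDES E S2) (φ : S1 → S2 → unitInterval) : Prop :=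
  (∀ i, G1.x0 i ≤ Finset.univ.sup fun j => G2.x0 j ⊓ φ i j) ∧
  (∀ j, (Finset.univ.sup fun i => G1.xm i ⊓ φ i j) ≤ G2.xm j) ∧
  (∀ e : E, ∀ j i, (Finset.univ.sup fun i' => φ i' j ⊓ G1.sig e i' i)
      ≤ Finset.univ.sup fun j' => G2.sig e j j' ⊓ φ i j')

/-- `G1 ⊆ G2`: some fuzzy simulation from `G1` to `G2` exists. -/
def Sim {E S1 S2 : Type} [Fintype S1] [Fintype S2]
    (G1 : FDES E S1) (G2 : FDES E S2) : Prop :=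
  ∃ φ, IsFuzzySim G1 G2 φ

/-- Fuzzy tensor of two matrices over `[0,1]`. -/
noncomputable def ftensor {α β γ δ : Type} (A : α → β → unitInterval) (B : γ → δ → unitInterval) :
    α × γ → β × δ → unitInterval :=
  fun p q => A p.1 q.1 ⊓ B p.2 q.2

/-- Parallel composition of two FDESs over the same event set. -/
noncomputable def par {E S1 S2 : Type} (G1 : FDES E S1) (G2 : FDES E S2) : FDES E (S1 × S2) where
  x0 := fun p => G1.x0 p.1 ⊓ G2.x0 p.2
  xm := fun p => G1.xm p.1 ⊓ G2.xm p.2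
  sig := fun e => ftensor (G1.sig e) (G2.sig e)

/-- The fuzzy state vector reached after executing the word `s`. -/
noncomputable def run {E S : Type} [Fintype S] (G : FDES E S) (s : List E) : S → unitInterval :=
  s.foldl (fun v e => vecMat v (G.sig e)) G.x0

/-- The fuzzy language generated by `G`. -/
noncomputable def lang {E S : Type} [Fintype S] (G : FDES E S) : List E → unitInterval
  | [] => 1
  | e :: s => Finset.univ.sup fun i => run G (e :: s) i

/-- `S` is fuzzy `Suc`-compatible: every row of every event matrix has an entry
at least the degree of uncontrollability of that event. -/
def Compatible {E S : Type} [Fintype S] (G : FDES E S) (Suc : E → unitInterval) : Prop :=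
  ∀ (e : E) (i : S), Suc e ≤ Finset.univ.sup fun j => G.sig e i j

/-- The augmented FDES `R⁺` obtained from `R` by adding one extra crisp state
(`none`), following Algorithm 1. -/
noncomputable def Rplus {E S : Type} [Fintype S] (R : FDES E S) (Suc : E → unitInterval) :
    FDES E (Option S) where
  x0 := fun s => match s with | some i => R.x0 i | none => 0
  xm := fun s => match s with | some i => R.xm i | none => 0
  sig := fun e p q => match p, q with
    | some i, some j => R.sig e i j
    | none, some _ => 0
    | none, none => Suc e
    | some i, none =>
        if Suc e ≤ Finset.univ.sup (fun j => R.sig e i j) then 0 else Suc e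

/-- Rounding `p` up to the least element `q` of `A` above it preserves upper bounds of `p ⊓ s`
that lie in `A`. -/
theorem IsLeast.inf_le_of_inf_le {α : Type*} [LinearOrder α] {A : Set α} {p q s b : α}
    (hq : IsLeast {a | a ∈ A ∧ p ≤ a} q) (hb : b ∈ A) (h : p ⊓ s ≤ b) : q ⊓ s ≤ b := by
  rcases inf_le_iff.mp h with h | h
  · exact inf_le_of_left_le (hq.2 ⟨hb, h⟩)
  · exact inf_le_of_right_le h

/-- A nonempty finite max-min product of elements of `A` lies in `A`. -/
theorem Finset.sup_inf_mem_of_forall_mem {α ι : Type*} [LinearOrder α] [OrderBot α] {A : Set α}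
    {t : Finset ι} (ht : t.Nonempty) {f g : ι → α} (hf : ∀ i, f i ∈ A) (hg : ∀ i, g i ∈ A) :
    (t.sup fun i => f i ⊓ g i) ∈ A := by
  obtain ⟨i, -, hi⟩ := t.exists_mem_eq_sup ht fun i => f i ⊓ g i
  rw [hi]
  rcases min_choice (f i) (g i) with h | h
  · exact h.symm ▸ hf i
  · exact h.symm ▸ hg i

/-- rounding a fuzzy simulation up to entries of the systems'
data yields a fuzzy simulation. -/
theorem stmt_0 {E S1 S2 : Type} [Fintype E] [Fintype S1] [Fintype S2]
    (G1 : FDES E S1) (G2 : FDES E S2)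
    (phi phiUp : S1 → S2 → unitInterval)
    (A : Set unitInterval)
    (hA : A = Set.range G1.x0 ∪ Set.range G1.xm ∪ Set.range G2.x0 ∪ Set.range G2.xm
        ∪ Set.range (fun p : E × S1 × S1 => G1.sig p.1 p.2.1 p.2.2)
        ∪ Set.range (fun p : E × S2 × S2 => G2.sig p.1 p.2.1 p.2.2))
    (hphi : IsFuzzySim G1 G2 phi)
    (hup : ∀ i j, IsLeast {a | a ∈ A ∧ phi i j ≤ a} (phiUp i j)) :
    IsFuzzySim G1 G2 phiUp := by
  have hle : ∀ i j, phi i j ≤ phiUp i j := fun i j => (hup i j).1.2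
  have hxm : ∀ j, G2.xm j ∈ A := fun j => by simp [hA]
  have hsig : ∀ e j j', G2.sig e j j' ∈ A := fun e j j' => by
    rw [hA]
    exact Or.inr ⟨(e, j, j'), rfl⟩
  obtain ⟨h0, hm, hs⟩ := hphi
  refine ⟨fun i => (h0 i).trans ?_, fun j => Finset.sup_le fun i _ => ?_,
    fun e j i => Finset.sup_le fun i' _ => ?_⟩
  · exact Finset.sup_mono_fun fun j _ => inf_le_inf_left _ (hle i j)
  · rw [inf_comm]
    refine (hup i j).inf_le_of_inf_le (hxm j) ?_
    rw [inf_comm]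
    exact Finset.sup_le_iff.mp (hm j) i (Finset.mem_univ i)
  · refine (hup i' j).inf_le_of_inf_le
      (Finset.sup_inf_mem_of_forall_mem ⟨j, Finset.mem_univ j⟩ (hsig e j)
        fun j' => (hup i j').1.1) ?_
    exact (Finset.sup_le_iff.mp (hs e j i) i' (Finset.mem_univ i')).trans
      (Finset.sup_mono_fun fun j' _ => inf_le_inf_left _ (hle i j'))
end

section
/- Let G1, G2, G3 be FDESs over the same finite event set E. If φ1 is a fuzzy simulation from G1 to G2 and φ2 is a fuzzy simulation from G2 to G3, then the max-min product φ1 ⊙ φ2 is a fuzzy simulation from G1 to G3. In particular, the fuzzy simulation preorder ⊆ on FDESs is transitive: G1 ⊆ G2 and G2 ⊆ G3 imply G1 ⊆ G3. -/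
open unitInterval

theorem maxmin_mono {α β γ : Type} [Fintype β] {A A' : α → β → unitInterval}
    {B B' : β → γ → unitInterval} (hA : A ≤ A') (hB : B ≤ B') : maxmin A B ≤ maxmin A' B' :=
  fun i k => Finset.sup_mono_fun fun j _ => inf_le_inf (hA i j) (hB j k)

theorem maxmin_assoc {α β γ δ : Type} [Fintype β] [Fintype γ] (A : α → β → unitInterval)
    (B : β → γ → unitInterval) (C : γ → δ → unitInterval) :
    maxmin (maxmin A B) C = maxmin A (maxmin B C) := by
  funext i l
  simp only [maxmin, Finset.sup_inf_distrib_right, Finset.sup_inf_distrib_left, inf_assoc]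
  exact Finset.sup_comm _ _ _

theorem flip_maxmin {α β γ : Type} [Fintype β] (A : α → β → unitInterval)
    (B : β → γ → unitInterval) : flip (maxmin A B) = maxmin (flip B) (flip A) := by
  funext k i
  simp only [flip, maxmin, inf_comm]

/-- Matrix form of the definition of a fuzzy simulation, with state vectors as one-row matrices. -/
theorem isFuzzySim_iff {E S1 S2 : Type} [Fintype S1] [Fintype S2] (G1 : FDES E S1)
    (G2 : FDES E S2) (φ : S1 → S2 → unitInterval) :
    IsFuzzySim G1 G2 φ ↔
      (fun _ : Unit => G1.x0) ≤ maxmin (fun _ : Unit => G2.x0) (flip φ) ∧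
      maxmin (fun _ : Unit => G1.xm) φ ≤ (fun _ : Unit => G2.xm) ∧
      ∀ e, maxmin (flip φ) (G1.sig e) ≤ maxmin (G2.sig e) (flip φ) :=
  ⟨fun h => ⟨fun _ => h.1, fun _ => h.2.1, h.2.2⟩, fun h => ⟨h.1 (), h.2.1 (), h.2.2⟩⟩

theorem IsFuzzySim.maxmin {E S1 S2 S3 : Type} [Fintype S1] [Fintype S2] [Fintype S3]
    {G1 : FDES E S1} {G2 : FDES E S2} {G3 : FDES E S3}
    {φ : S1 → S2 → unitInterval} {ψ : S2 → S3 → unitInterval}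
    (h1 : IsFuzzySim G1 G2 φ) (h2 : IsFuzzySim G2 G3 ψ) :
    IsFuzzySim G1 G3 (maxmin φ ψ) := by
  rw [isFuzzySim_iff] at h1 h2 ⊢
  obtain ⟨init1, mark1, step1⟩ := h1
  obtain ⟨init2, mark2, step2⟩ := h2
  rw [flip_maxmin]
  refine ⟨?_, ?_, fun e => ?_⟩
  · rw [← maxmin_assoc]
    exact init1.trans (maxmin_mono init2 le_rfl)
  · rw [← maxmin_assoc]
    exact (maxmin_mono mark1 le_rfl).trans mark2
  · rw [maxmin_assoc, ← maxmin_assoc (G3.sig e)]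
    refine (maxmin_mono le_rfl (step1 e)).trans ?_
    rw [← maxmin_assoc]
    exact maxmin_mono (step2 e) le_rfl

theorem Sim.trans {E S1 S2 S3 : Type} [Fintype S1] [Fintype S2] [Fintype S3]
    {G1 : FDES E S1} {G2 : FDES E S2} {G3 : FDES E S3} (h1 : Sim G1 G2) (h2 : Sim G2 G3) :
    Sim G1 G3 :=
  let ⟨_, hφ⟩ := h1
  let ⟨_, hψ⟩ := h2
  ⟨_, hφ.maxmin hψ⟩

/-- the max-min product of fuzzy simulations is a fuzzy
simulation; in particular the fuzzy simulation preorder is transitive. -/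
theorem stmt_1 {E S1 S2 S3 : Type} [Fintype S1] [Fintype S2] [Fintype S3]
    (G1 : FDES E S1) (G2 : FDES E S2) (G3 : FDES E S3)
    (phi1 : S1 → S2 → unitInterval) (phi2 : S2 → S3 → unitInterval)
    (h1 : IsFuzzySim G1 G2 phi1) (h2 : IsFuzzySim G2 G3 phi2) :
    IsFuzzySim G1 G3 (maxmin phi1 phi2) ∧
      (∀ {T1 T2 T3 : Type} [Fintype T1] [Fintype T2] [Fintype T3]
        (H1 : FDES E T1) (H2 : FDES E T2) (H3 : FDES E T3),
        Sim H1 H2 → Sim H2 H3 → Sim H1 H3) :=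
  ⟨h1.maxmin h2, fun _ _ _ => Sim.trans⟩
end

section
/- Let A be a k×m matrix, B a p×s matrix, C an m×n matrix, and D an s×r matrix, all with entries in [0,1]. Then (A ⊗̃ B) ⊙ (C ⊗̃ D) = (A ⊙ C) ⊗̃ (B ⊙ D), where ⊙ is the max-min matrix product and ⊗̃ is the fuzzy tensor. -/
open unitInterval

/-- `(A ⊗̃ B) ⊙ (C ⊗̃ D) = (A ⊙ C) ⊗̃ (B ⊙ D)`. -/
theorem stmt_2 {k m p s n r : ℕ}
    (A : Fin k → Fin m → unitInterval) (B : Fin p → Fin s → unitInterval)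
    (C : Fin m → Fin n → unitInterval) (D : Fin s → Fin r → unitInterval) :
    maxmin (ftensor A B) (ftensor C D) = ftensor (maxmin A C) (maxmin B D) := by
  funext x y
  simp only [maxmin, ftensor, Finset.sup_inf_sup, Finset.univ_product_univ]
  exact Finset.sup_congr rfl fun _ _ => inf_inf_inf_comm _ _ _ _
end

section
/- Let G1, G2, G3 be FDESs over the same finite event set E. If G1 ⊆ G3 then G1 || G2 ⊆ G3; likewise, if G2 ⊆ G3 then G1 || G2 ⊆ G3. -/
open unitInterval

/-- A state map along which all degrees of `H` are dominated by those of `G` pulls back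
simulations from `G` to simulations from `H`. -/
theorem Sim.of_map {E S T U : Type} [Fintype S] [Fintype T] [Fintype U]
    {G : FDES E S} {H : FDES E T} {K : FDES E U} (f : T → S)
    (hx0 : ∀ t, H.x0 t ≤ G.x0 (f t)) (hxm : ∀ t, H.xm t ≤ G.xm (f t))
    (hsig : ∀ e t t', H.sig e t t' ≤ G.sig e (f t) (f t')) (h : Sim G K) : Sim H K := by
  obtain ⟨φ, ha, hb, hc⟩ := h
  refine ⟨fun t => φ (f t), fun t => (hx0 t).trans (ha (f t)), fun u => ?_, fun e u t => ?_⟩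
  · exact Finset.sup_le fun t _ => (inf_le_inf_right _ (hxm t)).trans <|
      (Finset.le_sup (f := fun s => G.xm s ⊓ φ s u) (Finset.mem_univ (f t))).trans (hb u)
  · exact Finset.sup_le fun t' _ => (inf_le_inf_left _ (hsig e t' t)).trans <|
      (Finset.le_sup (f := fun s => φ s u ⊓ G.sig e s (f t)) (Finset.mem_univ (f t'))).trans
        (hc e u (f t))

/-- if `G1 ⊆ G3` then `G1 || G2 ⊆ G3`; likewise if `G2 ⊆ G3`
then `G1 || G2 ⊆ G3`. -/
theorem stmt_3 {E S1 S2 S3 : Type} [Fintype E] [Fintype S1] [Fintype S2] [Fintype S3]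
    (G1 : FDES E S1) (G2 : FDES E S2) (G3 : FDES E S3) :
    (Sim G1 G3 → Sim (par G1 G2) G3) ∧ (Sim G2 G3 → Sim (par G1 G2) G3) := by
  exact ⟨Sim.of_map Prod.fst (fun _ => inf_le_left) (fun _ => inf_le_left)
      (fun _ _ _ => inf_le_left),
    Sim.of_map Prod.snd (fun _ => inf_le_right) (fun _ => inf_le_right)
      (fun _ _ _ => inf_le_right)⟩
end

section
/- Let G1 and G2 be FDESs over the same finite event set E. Then G1 || G2 ⊆ G1 and G1 || G2 ⊆ G2, i.e., the parallel composition is fuzzy simulated by each of its components. -/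
open unitInterval

/-- A map of crisp states that does not decrease the fuzzy data induces a fuzzy simulation,
namely the indicator of its graph. -/
theorem Sim.of_map_s4 {E S1 S2 : Type} [Fintype S1] [Fintype S2]
    {G1 : FDES E S1} {G2 : FDES E S2} (f : S1 → S2)
    (h0 : ∀ i, G1.x0 i ≤ G2.x0 (f i)) (hm : ∀ i, G1.xm i ≤ G2.xm (f i))
    (hs : ∀ e i j, G1.sig e i j ≤ G2.sig e (f i) (f j)) : Sim G1 G2 := by
  classical
  refine ⟨fun i j => if f i = j then ⊤ else ⊥, fun i => ?_, fun j => ?_, fun e j i => ?_⟩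
  · refine le_trans ?_ (Finset.le_sup (Finset.mem_univ (f i)))
    simpa using h0 i
  · refine Finset.sup_le fun i _ => ?_
    by_cases h : f i = j
    · subst h
      simpa using hm i
    · simp [h]
  · refine Finset.sup_le fun i' _ => ?_
    by_cases h : f i' = j
    · subst h
      refine le_trans ?_ (Finset.le_sup (Finset.mem_univ (f i)))
      simpa using hs e i' i
    · simp [h]

/-- the parallel composition is fuzzy simulated by each of its
components. -/
theorem stmt_4 {E S1 S2 : Type} [Fintype E] [Fintype S1] [Fintype S2]
    (G1 : FDES E S1) (G2 : FDES E S2) :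
    Sim (par G1 G2) G1 ∧ Sim (par G1 G2) G2 := by
  exact ⟨Sim.of_map_s4 Prod.fst (fun _ => inf_le_left) (fun _ => inf_le_left)
      (fun _ _ _ => inf_le_left),
    Sim.of_map_s4 Prod.snd (fun _ => inf_le_right) (fun _ => inf_le_right)
      (fun _ _ _ => inf_le_right)⟩
end

section
/- Let G1 and G2 be FDESs over the same finite event set E. Then for every finite word s over E, the fuzzy language generated by the parallel composition satisfies L_{G1||G2}(s) = min( L_{G1}(s), L_{G2}(s) ). -/
open unitInterval

theorem sup_univ_prod_inf {α β : Type} [Fintype α] [Fintype β]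
    (f : α → unitInterval) (g : β → unitInterval) :
    (Finset.univ.sup fun p : α × β => f p.1 ⊓ g p.2) =
      Finset.univ.sup f ⊓ Finset.univ.sup g := by
  rw [Finset.sup_inf_sup, Finset.univ_product_univ]

theorem vecMat_ftensor {α β γ δ : Type} [Fintype α] [Fintype γ]
    (x : α → unitInterval) (y : γ → unitInterval)
    (A : α → β → unitInterval) (B : γ → δ → unitInterval) :
    vecMat (fun p : α × γ => x p.1 ⊓ y p.2) (ftensor A B) =
      fun q => vecMat x A q.1 ⊓ vecMat y B q.2 := by
  funext q
  exact (Finset.sup_congr rfl fun p _ => inf_inf_inf_comm _ _ _ _).trans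
    (sup_univ_prod_inf (fun i => x i ⊓ A i q.1) fun k => y k ⊓ B k q.2)

theorem foldl_vecMat_ftensor {E S1 S2 : Type} [Fintype S1] [Fintype S2]
    (a : E → S1 → S1 → unitInterval) (b : E → S2 → S2 → unitInterval) (s : List E)
    (x : S1 → unitInterval) (y : S2 → unitInterval) :
    s.foldl (fun v e => vecMat v (ftensor (a e) (b e))) (fun p : S1 × S2 => x p.1 ⊓ y p.2) =
      fun p => s.foldl (fun v e => vecMat v (a e)) x p.1 ⊓
        s.foldl (fun v e => vecMat v (b e)) y p.2 := by
  induction s generalizing x y with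
  | nil => rfl
  | cons e s ih => simp only [List.foldl_cons, vecMat_ftensor, ih]

theorem run_par {E S1 S2 : Type} [Fintype S1] [Fintype S2]
    (G1 : FDES E S1) (G2 : FDES E S2) (s : List E) :
    run (par G1 G2) s = fun p => run G1 s p.1 ⊓ run G2 s p.2 :=
  foldl_vecMat_ftensor G1.sig G2.sig s G1.x0 G2.x0

/-- the fuzzy language generated by a parallel composition is the
pointwise minimum of the components' fuzzy languages. -/
theorem stmt_5 {E S1 S2 : Type} [Fintype E] [Fintype S1] [Fintype S2]
    (G1 : FDES E S1) (G2 : FDES E S2) (s : List E) :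
    lang (par G1 G2) s = lang G1 s ⊓ lang G2 s := by
  cases s with
  | nil => simp [lang]
  | cons e s =>
    simp only [lang, run_par]
    exact sup_univ_prod_inf _ _
end

section
/- Let G1, G2, G3 be FDESs over the same finite event set E. If G3 ⊆ G1 and G3 ⊆ G2, then G3 ⊆ G1 || G2. Moreover, if φ1 is a fuzzy simulation from G3 to G1 and φ2 is a fuzzy simulation from G3 to G2, then the matrix φ defined by φ(p, (q,r)) = min( φ1(p,q), φ2(p,r) ) is a fuzzy simulation from G3 to G1 || G2. -/
open unitInterval

theorem le_sup_univ_prod {α β : Type} [Fintype α] [Fintype β] {a : unitInterval}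
    {f u : α → unitInterval} {g v : β → unitInterval}
    (hf : a ≤ Finset.univ.sup fun j => f j ⊓ u j)
    (hg : a ≤ Finset.univ.sup fun k => g k ⊓ v k) :
    a ≤ Finset.univ.sup fun p : α × β => (f p.1 ⊓ g p.2) ⊓ (u p.1 ⊓ v p.2) := by
  refine (le_inf hf hg).trans ?_
  rw [Finset.sup_inf_sup]
  refine Finset.sup_le fun p _ => ?_
  rw [inf_inf_inf_comm]
  exact Finset.le_sup (f := fun p : α × β => (f p.1 ⊓ g p.2) ⊓ (u p.1 ⊓ v p.2))
    (Finset.mem_univ p)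

theorem IsFuzzySim.par {E S1 S2 S3 : Type} [Fintype S1] [Fintype S2] [Fintype S3]
    {G1 : FDES E S1} {G2 : FDES E S2} {G3 : FDES E S3}
    {phi1 : S3 → S1 → unitInterval} {phi2 : S3 → S2 → unitInterval}
    (h1 : IsFuzzySim G3 G1 phi1) (h2 : IsFuzzySim G3 G2 phi2) :
    IsFuzzySim G3 (par G1 G2) (fun p q => phi1 p q.1 ⊓ phi2 p q.2) := by
  obtain ⟨a1, b1, c1⟩ := h1
  obtain ⟨a2, b2, c2⟩ := h2
  refine ⟨fun i => le_sup_univ_prod (a1 i) (a2 i), fun j => le_inf ?_ ?_,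
    fun e j i => le_sup_univ_prod (le_trans ?_ (c1 e j.1 i)) (le_trans ?_ (c2 e j.2 i))⟩
  · exact (Finset.sup_mono_fun fun _ _ => inf_le_inf_left _ inf_le_left).trans (b1 j.1)
  · exact (Finset.sup_mono_fun fun _ _ => inf_le_inf_left _ inf_le_right).trans (b2 j.2)
  · exact Finset.sup_mono_fun fun _ _ => inf_le_inf_right _ inf_le_left
  · exact Finset.sup_mono_fun fun _ _ => inf_le_inf_right _ inf_le_right

/-- `G3 ⊆ G1` and `G3 ⊆ G2` imply `G3 ⊆ G1 || G2`; moreover the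
entrywise minimum of the two simulations is a simulation into the
composition. -/
theorem stmt_6 {E S1 S2 S3 : Type} [Fintype E] [Fintype S1] [Fintype S2] [Fintype S3]
    (G1 : FDES E S1) (G2 : FDES E S2) (G3 : FDES E S3) :
    (Sim G3 G1 → Sim G3 G2 → Sim G3 (par G1 G2)) ∧
      (∀ (phi1 : S3 → S1 → unitInterval) (phi2 : S3 → S2 → unitInterval),
        IsFuzzySim G3 G1 phi1 → IsFuzzySim G3 G2 phi2 →
          IsFuzzySim G3 (par G1 G2) (fun p q => phi1 p q.1 ⊓ phi2 p q.2)) :=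
  ⟨fun ⟨_, h1⟩ ⟨_, h2⟩ => ⟨_, h1.par h2⟩, fun _ _ h1 h2 => h1.par h2⟩
end

section
/- Let G1, G2, G3 be FDESs over the same finite event set E. If G3 ⊆ G1 || G2, then G3 ⊆ G1 and G3 ⊆ G2. Moreover, if φ3 is a fuzzy simulation from G3 to G1 || G2, then the matrix φ1 defined by φ1(p,q) = max_r φ3(p,(q,r)) is a fuzzy simulation from G3 to G1 (and symmetrically φ2(p,r) = max_q φ3(p,(q,r)) is a fuzzy simulation from G3 to G2). -/
open unitInterval

/-- Let `g : T → U → S` be an indexing of all the states of `H` by pairs such that the data of `H`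
are dominated by the data of `G` at the first coordinate. Then maximizing a simulation into `H`
over the second coordinate gives a simulation into `G`. -/
theorem IsFuzzySim.sup_of_dominated {E R S T U : Type} [Fintype R] [Fintype S] [Fintype T]
    [Fintype U] {F : FDES E R} {H : FDES E S} {G : FDES E T} {φ : R → S → unitInterval}
    (h : IsFuzzySim F H φ) (g : T → U → S) (hg : ∀ s, ∃ t u, g t u = s)
    (hx0 : ∀ t u, H.x0 (g t u) ≤ G.x0 t) (hxm : ∀ t u, H.xm (g t u) ≤ G.xm t)
    (hsig : ∀ e t u t' u', H.sig e (g t u) (g t' u') ≤ G.sig e t t') :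
    IsFuzzySim F G (fun p t => Finset.univ.sup fun u : U => φ p (g t u)) := by
  obtain ⟨h0, hm, hs⟩ := h
  have key : ∀ (a : S → unitInterval) (b : T → unitInterval), (∀ t u, a (g t u) ≤ b t) → ∀ p,
      (Finset.univ.sup fun s => a s ⊓ φ p s) ≤
        Finset.univ.sup fun t => b t ⊓ Finset.univ.sup fun u : U => φ p (g t u) := by
    intro a b hab p
    refine Finset.sup_le fun s _ => ?_
    obtain ⟨t, u, rfl⟩ := hg s
    exact (inf_le_inf (hab t u)
      (Finset.le_sup (f := fun u => φ p (g t u)) (Finset.mem_univ u))).trans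
      (Finset.le_sup (f := fun t => b t ⊓ Finset.univ.sup fun u : U => φ p (g t u))
        (Finset.mem_univ t))
  refine ⟨fun i => (h0 i).trans (key _ _ hx0 i), fun t => Finset.sup_le fun i _ => ?_,
    fun e t i => Finset.sup_le fun i' _ => ?_⟩
  · rw [Finset.sup_inf_distrib_left]
    refine Finset.sup_le fun u _ => le_trans ?_ (hxm t u)
    exact (Finset.le_sup (f := fun i => F.xm i ⊓ φ i (g t u)) (Finset.mem_univ i)).trans
      (hm (g t u))
  · rw [Finset.sup_inf_distrib_right]
    refine Finset.sup_le fun u _ => le_trans ?_ (key _ _ (hsig e t u) i)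
    exact (Finset.le_sup (f := fun i' => φ i' (g t u) ⊓ F.sig e i' i) (Finset.mem_univ i')).trans
      (hs e (g t u) i)

/-- `G3 ⊆ G1 || G2` implies `G3 ⊆ G1` and `G3 ⊆ G2`; moreover the
row-maxima projections of the simulation are simulations into the
components. -/
theorem stmt_7 {E S1 S2 S3 : Type} [Fintype E] [Fintype S1] [Fintype S2] [Fintype S3]
    (G1 : FDES E S1) (G2 : FDES E S2) (G3 : FDES E S3) :
    (Sim G3 (par G1 G2) → Sim G3 G1 ∧ Sim G3 G2) ∧
      (∀ phi3 : S3 → S1 × S2 → unitInterval, IsFuzzySim G3 (par G1 G2) phi3 →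
        IsFuzzySim G3 G1 (fun p q => Finset.univ.sup fun r : S2 => phi3 p (q, r)) ∧
        IsFuzzySim G3 G2 (fun p r => Finset.univ.sup fun q : S1 => phi3 p (q, r))) := by
  have h : ∀ phi3 : S3 → S1 × S2 → unitInterval, IsFuzzySim G3 (par G1 G2) phi3 →
      IsFuzzySim G3 G1 (fun p q => Finset.univ.sup fun r : S2 => phi3 p (q, r)) ∧
      IsFuzzySim G3 G2 (fun p r => Finset.univ.sup fun q : S1 => phi3 p (q, r)) :=
    fun _ hphi =>
      ⟨hphi.sup_of_dominated (fun q r => (q, r)) (fun s => ⟨s.1, s.2, rfl⟩)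
          (fun _ _ => inf_le_left) (fun _ _ => inf_le_left) (fun _ _ _ _ _ => inf_le_left),
        hphi.sup_of_dominated (fun r q => (q, r)) (fun s => ⟨s.2, s.1, rfl⟩)
          (fun _ _ => inf_le_right) (fun _ _ => inf_le_right) (fun _ _ _ _ _ => inf_le_right)⟩
  exact ⟨fun ⟨phi, hphi⟩ => ⟨⟨_, (h phi hphi).1⟩, ⟨_, (h phi hphi).2⟩⟩, h⟩
end

section
/- Let R be an FDES over a finite event set E with n states and let Σuc : E → [0,1] be a degree-of-uncontrollability assignment. Then R ⊆ R⁺; in fact the n×(n+1) matrix φ = (I_n | 0), which has 1 on the diagonal entries (i,i) for i ≤ n and 0 elsewhere, is a fuzzy simulation from R to R⁺. -/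
open unitInterval

/-- `R ⊆ R⁺`, witnessed by the matrix `(I_n | 0)`. -/
theorem stmt_9 {E S : Type} [Fintype E] [Fintype S] [DecidableEq S]
    (R : FDES E S) (Suc : E → unitInterval) :
    IsFuzzySim R (Rplus R Suc)
      (fun i q => match q with
        | some j => if i = j then 1 else 0
        | none => 0) ∧
    Sim R (Rplus R Suc) := by
  refine (and_self_iff.2 ?_).imp_right fun h => ⟨_, h⟩
  refine ⟨fun i => ?_, fun q => Finset.sup_le fun i _ => ?_,
    fun e q i => Finset.sup_le fun k _ => ?_⟩
  · refine le_trans ?_ (Finset.le_sup (Finset.mem_univ (some i)))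
    simp [Rplus, unitInterval.le_one']
  · cases q with
    | none => simp [Rplus]
    | some j =>
      by_cases h : i = j
      · subst h
        exact inf_le_left
      · simp [h]
  · cases q with
    | none => simp
    | some j =>
      by_cases h : k = j
      · subst h
        refine le_trans ?_ (Finset.le_sup (Finset.mem_univ (some i)))
        simp [Rplus]
      · simp [h]
end

section
/- Let R be an FDES over a finite event set E with n states, let Σuc : E → [0,1] be a degree-of-uncontrollability assignment, and let S be any fuzzy Σuc-compatible FDES over E. If R ⊆ S, then R⁺ ⊆ S. -/
open unitInterval

/-- if `S` is fuzzy `Suc`-compatible and `R ⊆ S`, then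
`R⁺ ⊆ S`. -/
theorem stmt_10 {E SR SY : Type} [Fintype E] [Fintype SR] [Fintype SY]
    (R : FDES E SR) (Suc : E → unitInterval) (S : FDES E SY)
    (hcomp : Compatible S Suc) (h : Sim R S) :
    Sim (Rplus R Suc) S := by
  obtain ⟨φ, hinit, hmark, hstep⟩ := h
  refine ⟨fun p j => p.elim 1 fun i => φ i j, ?_, ?_, ?_⟩
  · rintro (_ | i)
    · exact unitInterval.nonneg'
    · exact hinit i
  · intro j
    refine Finset.sup_le ?_
    rintro (_ | i) -
    · exact inf_le_left.trans unitInterval.nonneg'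
    · exact (Finset.le_sup (f := fun i => R.xm i ⊓ φ i j) (Finset.mem_univ i)).trans (hmark j)
  · rintro e j (_ | i)
    · have hsup : Suc e ≤ Finset.univ.sup fun j' => S.sig e j j' ⊓ 1 :=
        (hcomp e j).trans
          (Finset.sup_mono_fun fun j' _ => le_inf le_rfl unitInterval.le_one')
      refine Finset.sup_le ?_
      rintro (_ | i') -
      · exact inf_le_right.trans hsup
      · refine inf_le_right.trans (le_trans ?_ hsup)
        dsimp only [Rplus]
        split_ifs
        · exact unitInterval.nonneg'
        · exact le_rfl
    · refine Finset.sup_le ?_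
      rintro (_ | i') -
      · exact inf_le_right.trans unitInterval.nonneg'
      · exact (Finset.le_sup (f := fun i' => φ i' j ⊓ R.sig e i' i) (Finset.mem_univ i')).trans
          (hstep e j i)
end

section
/- Let G1 and G2 be FDESs over the same finite event set E. If G1 ⊆ G2 (there exists a fuzzy simulation from G1 to G2), then for every finite word s over E, L_{G1}(s) ≤ L_{G2}(s). -/
open unitInterval

theorem vecMat_mono {β γ : Type} [Fintype β] {x y : β → unitInterval} (hxy : x ≤ y)
    (B : β → γ → unitInterval) : vecMat x B ≤ vecMat y B :=
  fun k => Finset.sup_mono_fun fun j _ => inf_le_inf_right (B j k) (hxy j)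

theorem vecMat_vecMat {α β γ : Type} [Fintype α] [Fintype β] (x : α → unitInterval)
    (A : α → β → unitInterval) (B : β → γ → unitInterval) :
    vecMat (vecMat x A) B = vecMat x (maxmin A B) := by
  funext k
  simp only [vecMat, maxmin, Finset.sup_inf_distrib_right, Finset.sup_inf_distrib_left, inf_assoc]
  exact Finset.sup_comm _ _ _

theorem vecMat_mono_right {β γ : Type} [Fintype β] (x : β → unitInterval)
    {A B : β → γ → unitInterval} (hAB : A ≤ B) : vecMat x A ≤ vecMat x B :=
  fun k => Finset.sup_mono_fun fun j _ => inf_le_inf_left (x j) (hAB j k)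

/-- A fuzzy simulation bounds the state vector reached in the simulated system, word by word. -/
theorem IsFuzzySim.run_le {E S1 S2 : Type} [Fintype S1] [Fintype S2]
    {G1 : FDES E S1} {G2 : FDES E S2} {φ : S1 → S2 → unitInterval}
    (h : IsFuzzySim G1 G2 φ) (s : List E) :
    run G1 s ≤ vecMat (run G2 s) fun j i => φ i j := by
  induction s using List.reverseRecOn with
  | nil => exact h.1
  | append_singleton s e ih =>
    have run_append {S : Type} [Fintype S] (G : FDES E S) :
        run G (s ++ [e]) = vecMat (run G s) (G.sig e) := by
      simp [run]
    rw [run_append, run_append, vecMat_vecMat]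
    refine (vecMat_mono ih _).trans ?_
    rw [vecMat_vecMat]
    exact vecMat_mono_right _ (h.2.2 e)

/-- `G1 ⊆ G2` implies `L_{G1} ≤ L_{G2}` pointwise. -/
theorem stmt_15 {E S1 S2 : Type} [Fintype E] [Fintype S1] [Fintype S2]
    (G1 : FDES E S1) (G2 : FDES E S2)
    (h : Sim G1 G2) (s : List E) :
    lang G1 s ≤ lang G2 s := by
  obtain ⟨φ, hφ⟩ := h
  cases s with
  | nil => exact le_rfl
  | cons e s =>
    refine Finset.sup_le fun i _ => (hφ.run_le (e :: s) i).trans ?_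
    exact Finset.sup_mono_fun fun j _ => inf_le_left
end

section
/- Let G1 and G2 be FDESs over the same finite event set E. If G1 ∼ G2 (fuzzy simulation equivalence, i.e., G1 ⊆ G2 and G2 ⊆ G1), then the generated fuzzy languages coincide: L_{G1}(s) = L_{G2}(s) for every finite word s over E. -/
open unitInterval

/-- Condition (c) of a fuzzy simulation propagates domination of state vectors through one event. -/
theorem vecMat_le_of_le {S1 S2 : Type} [Fintype S1] [Fintype S2]
    {A : S1 → S1 → unitInterval} {B : S2 → S2 → unitInterval} {φ : S1 → S2 → unitInterval}
    (hφ : ∀ j i, (Finset.univ.sup fun i' => φ i' j ⊓ A i' i) ≤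
      Finset.univ.sup fun j' => B j j' ⊓ φ i j')
    {v : S1 → unitInterval} {w : S2 → unitInterval}
    (h : ∀ i, v i ≤ Finset.univ.sup fun j => w j ⊓ φ i j) (i : S1) :
    vecMat v A i ≤ Finset.univ.sup fun j => vecMat w B j ⊓ φ i j := by
  refine Finset.sup_le fun i' _ => (inf_le_inf_right _ (h i')).trans ?_
  rw [Finset.sup_inf_distrib_right]
  refine Finset.sup_le fun j _ => ?_
  have hj : φ i' j ⊓ A i' i ≤ Finset.univ.sup fun j' => B j j' ⊓ φ i j' :=
    (Finset.le_sup (f := fun i' => φ i' j ⊓ A i' i) (Finset.mem_univ i')).trans (hφ j i)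
  rw [inf_assoc]
  refine (inf_le_inf_left _ hj).trans ?_
  rw [Finset.sup_inf_distrib_left]
  refine Finset.sup_le fun j' _ => ?_
  rw [← inf_assoc]
  exact (inf_le_inf_right _
    (Finset.le_sup (f := fun j => w j ⊓ B j j') (Finset.mem_univ j))).trans
    (Finset.le_sup (f := fun j' => vecMat w B j' ⊓ φ i j') (Finset.mem_univ j'))

theorem foldl_vecMat_le_of_le {E S1 S2 : Type} [Fintype S1] [Fintype S2]
    {G1 : FDES E S1} {G2 : FDES E S2} {φ : S1 → S2 → unitInterval} (hφ : IsFuzzySim G1 G2 φ)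
    (s : List E) {v : S1 → unitInterval} {w : S2 → unitInterval}
    (h : ∀ i, v i ≤ Finset.univ.sup fun j => w j ⊓ φ i j) (i : S1) :
    s.foldl (fun v e => vecMat v (G1.sig e)) v i ≤
      Finset.univ.sup fun j => s.foldl (fun v e => vecMat v (G2.sig e)) w j ⊓ φ i j := by
  induction s generalizing v w with
  | nil => exact h i
  | cons e s ih => exact ih (vecMat_le_of_le (hφ.2.2 e) h)

/-- Fuzzy simulation implies inclusion of generated fuzzy languages. -/
theorem Sim.lang_le {E S1 S2 : Type} [Fintype S1] [Fintype S2]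
    {G1 : FDES E S1} {G2 : FDES E S2} (h : Sim G1 G2) (s : List E) :
    lang G1 s ≤ lang G2 s := by
  obtain ⟨φ, hφ⟩ := h
  cases s with
  | nil => exact le_rfl
  | cons e s =>
    exact Finset.sup_le fun i _ => (foldl_vecMat_le_of_le hφ (e :: s) hφ.1 i).trans
      (Finset.sup_mono_fun fun _ _ => inf_le_left)

/-- fuzzy simulation equivalence implies language equality. -/
theorem stmt_16 {E S1 S2 : Type} [Fintype E] [Fintype S1] [Fintype S2]
    (G1 : FDES E S1) (G2 : FDES E S2)
    (h1 : Sim G1 G2) (h2 : Sim G2 G1) (s : List E) :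
    lang G1 s = lang G2 s :=
  le_antisymm (h1.lang_le s) (h2.lang_le s)
end

section
/- Let G1 and G3 be FDESs over the same finite event set E, with G1 having m states, and let G2 be any FDES over E with n states. If φ1 is a fuzzy simulation from G1 to G3, then the matrix φ2 defined by φ2((i,k), j) = φ1(i, j) for all i ≤ m, k ≤ n, and columns j of φ1 (i.e., φ2 = φ1 ⊗̃ 1ₙᵀ, where 1ₙ is the all-ones row vector of length n) is a fuzzy simulation from G1 || G2 to G3. -/
open unitInterval

/-- if `phi1` is a fuzzy simulation from `G1` to `G3`, then
`phi1 ⊗̃ 1ₙᵀ`, i.e. `(i,k) ↦ j ↦ phi1 i j`, is a fuzzy simulation from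
`G1 || G2` to `G3`. -/
theorem stmt_18 {E S1 S2 S3 : Type} [Fintype E] [Fintype S1] [Fintype S2] [Fintype S3]
    (G1 : FDES E S1) (G2 : FDES E S2) (G3 : FDES E S3)
    (phi1 : S1 → S3 → unitInterval)
    (h : IsFuzzySim G1 G3 phi1) :
    IsFuzzySim (par G1 G2) G3 (fun p j => phi1 p.1 j) := by
  obtain ⟨h_init, h_mark, h_step⟩ := h
  refine ⟨fun p => inf_le_left.trans (h_init p.1), fun j => ?_, fun e j p => ?_⟩
  · refine Finset.sup_le fun q _ => le_trans ?_ (h_mark j)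
    exact (inf_le_inf_right _ inf_le_left).trans
      (Finset.le_sup (f := fun i => G1.xm i ⊓ phi1 i j) (Finset.mem_univ q.1))
  · refine Finset.sup_le fun q _ => le_trans ?_ (h_step e j p.1)
    exact (inf_le_inf_left _ inf_le_left).trans
      (Finset.le_sup (f := fun i => phi1 i j ⊓ G1.sig e i p.1) (Finset.mem_univ q.1))
end
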